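/- arXiv:1106.3625 — 2 statements merged into one kernel-verified Lean document; each statement's English description precedes it below -/
import Mathlib

section
/- Let C be a linear [n,k,d]_q code with information locality r, where r | k, r < k, and n = k + k/r + d − 2. Then every set S ⊆ [n] with |S| ≤ r+1 for which there exist nonzero scalars λ_i (i ∈ S) with Σ_{i∈S} λ_i c_i = 0 satisfies |S| = r+1, and any two distinct such sets S are disjoint. -/
open Matrix Finset

/-- The Hamming weight of the codeword encoding `x` under the code with points `c`. -/
def codewordWeight {n k : ℕ} {F : Type} [Field F] [DecidableEq F]
    (c : Fin n → Fin k → F) (x : Fin k → F) : ℕ :=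
  (Finset.univ.filter fun i : Fin n => c i ⬝ᵥ x ≠ 0).card

/-- The code determined by the points `c` has minimum distance `d`. -/
def HasDistance {n k : ℕ} {F : Type} [Field F] [DecidableEq F]
    (c : Fin n → Fin k → F) (d : ℕ) : Prop :=
  (∀ x : Fin k → F, x ≠ 0 → d ≤ codewordWeight c x) ∧
  (∃ x : Fin k → F, x ≠ 0 ∧ codewordWeight c x = d)

/-- `loc(c_i) ≤ r`: the point `c i` is a linear combination of at most `r` other points. -/
def LocLE {n k : ℕ} {F : Type} [Field F]
    (c : Fin n → Fin k → F) (i : Fin n) (r : ℕ) : Prop :=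
  ∃ R : Finset (Fin n), i ∉ R ∧ R.card ≤ r ∧
    ∃ lam : Fin n → F, c i = ∑ j ∈ R, lam j • c j

/-- The code has information locality `r`: some spanning subset of points has locality ≤ r. -/
def InfoLocality {n k : ℕ} {F : Type} [Field F]
    (c : Fin n → Fin k → F) (r : ℕ) : Prop :=
  ∃ I : Set (Fin n), Submodule.span F (c '' I) = ⊤ ∧ ∀ i ∈ I, LocLE c i r

/-- `S` is the support of a nonzero dual codeword of weight at most `r+1`:
    there are nonzero scalars `λ_i` (i ∈ S) with `Σ_{i∈S} λ_i c_i = 0`. -/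
def SmallDualSupport {n k : ℕ} {F : Type} [Field F]
    (c : Fin n → Fin k → F) (r : ℕ) (S : Finset (Fin n)) : Prop :=
  S.Nonempty ∧ S.card ≤ r + 1 ∧
    ∃ lam : Fin n → F, (∀ i ∈ S, lam i ≠ 0) ∧ ∑ i ∈ S, lam i • c i = 0

/-- The rank of the set of points of the code indexed by `A`. -/
noncomputable def pointRank {n k : ℕ} {F : Type} [Field F]
    (c : Fin n → Fin k → F) (A : Finset (Fin n)) : ℕ :=
  Module.finrank F (Submodule.span F (c '' (A : Set (Fin n))))

/-- Adding a set `T` of points to `A`, one of which is new and spanned by the rest of `T`,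
    increases the nullity. -/
theorem pointRank_union_lt {n k : ℕ} {F : Type} [Field F]
    (c : Fin n → Fin k → F) (A T : Finset (Fin n)) (i : Fin n) (hiT : i ∈ T) (hiA : i ∉ A)
    (hi : c i ∈ Submodule.span F (c '' ((T.erase i : Finset (Fin n)) : Set (Fin n)))) :
    pointRank c (A ∪ T) + 1 ≤ pointRank c A + (T \ A).card := by
  classical
  have hle : Submodule.span F (c '' ((A ∪ T : Finset (Fin n)) : Set (Fin n))) ≤
      Submodule.span F (c '' (A : Set (Fin n))) ⊔
        Submodule.span F ((((T \ A).erase i).image c : Finset (Fin k → F)) : Set (Fin k → F)) := by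
    have hmem : ∀ j ∈ A ∪ T, j ≠ i → c j ∈ Submodule.span F (c '' (A : Set (Fin n))) ⊔
        Submodule.span F
          ((((T \ A).erase i).image c : Finset (Fin k → F)) : Set (Fin k → F)) := by
      intro j hj hji
      by_cases hjA : j ∈ A
      · exact Submodule.mem_sup_left (Submodule.subset_span ⟨j, hjA, rfl⟩)
      · refine Submodule.mem_sup_right (Submodule.subset_span ?_)
        simp only [Finset.coe_image]
        exact ⟨j, by simp_all, rfl⟩
    rw [Submodule.span_le]
    rintro _ ⟨j, hj, rfl⟩
    by_cases hji : j = i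
    · subst hji
      refine (Submodule.span_le.2 ?_) hi
      rintro _ ⟨l, hl, rfl⟩
      have hl' := Finset.mem_erase.1 (Finset.mem_coe.1 hl)
      exact hmem l (Finset.mem_union_right _ hl'.2) hl'.1
    · exact hmem j hj hji
  have h1 := Submodule.finrank_mono hle
  have h2 := Submodule.finrank_add_le_finrank_add_finrank
    (Submodule.span F (c '' (A : Set (Fin n))))
    (Submodule.span F ((((T \ A).erase i).image c : Finset (Fin k → F)) : Set (Fin k → F)))
  have h3 := finrank_span_finset_le_card (R := F) (((T \ A).erase i).image c)
  have h4 : (((T \ A).erase i).image c).card ≤ ((T \ A).erase i).card := Finset.card_image_le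
  have h5 : ((T \ A).erase i).card + 1 = (T \ A).card :=
    Finset.card_erase_add_one (Finset.mem_sdiff.2 ⟨hiT, hiA⟩)
  unfold pointRank
  unfold Set.finrank at h3
  omega

/-- Adding one point raises the rank by at most one. -/
theorem pointRank_insert_le {n k : ℕ} {F : Type} [Field F]
    (c : Fin n → Fin k → F) (A : Finset (Fin n)) (i : Fin n) :
    pointRank c (insert i A) ≤ pointRank c A + 1 := by
  have h := Submodule.finrank_add_le_finrank_add_finrank
    (Submodule.span F {c i}) (Submodule.span F (c '' (A : Set (Fin n))))
  have h1 := finrank_span_le_card (R := F) ({c i} : Set (Fin k → F))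
  unfold pointRank
  rw [Finset.coe_insert, Set.image_insert_eq, Submodule.span_insert]
  simp only [Set.toFinset_singleton, Finset.card_singleton] at h1
  omega

/-- If the points of `I` span the space, a set of deficient rank misses one of them. -/
theorem exists_notMem_of_pointRank_lt {n k : ℕ} {F : Type} [Field F]
    (c : Fin n → Fin k → F) (I : Set (Fin n)) (hI : Submodule.span F (c '' I) = ⊤)
    (A : Finset (Fin n)) (hA : pointRank c A < k) : ∃ i ∈ I, i ∉ A := by
  by_contra! h
  have : Submodule.span F (c '' (A : Set (Fin n))) = ⊤ :=
    top_le_iff.1 (hI ▸ Submodule.span_mono (Set.image_mono h))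
  rw [pointRank, this, finrank_top, Module.finrank_fin_fun] at hA
  exact hA.false

/-- Points of deficient rank lie on a hyperplane, whose codeword vanishes on all of them. -/
theorem card_add_distance_le {n k d : ℕ} {F : Type} [Field F] [DecidableEq F]
    (c : Fin n → Fin k → F) (hd : HasDistance c d) (A : Finset (Fin n))
    (hA : pointRank c A < k) : A.card + d ≤ n := by
  have hlt : Submodule.span F (c '' (A : Set (Fin n))) < ⊤ := by
    refine lt_top_iff_ne_top.2 fun h => ?_
    rw [pointRank, h, finrank_top, Module.finrank_fin_fun] at hA
    exact hA.false
  obtain ⟨f, hf, hker⟩ := Submodule.exists_le_ker_of_lt_top _ hlt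
  obtain ⟨x, rfl⟩ := (dotProductEquiv F (Fin k)).surjective f
  have hx : x ≠ 0 := by
    rintro rfl
    simp at hf
  have hw := hd.1 x hx
  have hsub : (Finset.univ.filter fun i : Fin n => c i ⬝ᵥ x ≠ 0) ⊆ Aᶜ := by
    intro i hi
    rw [Finset.mem_compl]
    intro hiA
    have h0 := hker (Submodule.subset_span ⟨i, hiA, rfl⟩)
    rw [LinearMap.mem_ker, dotProductEquiv_apply_apply, dotProduct_comm] at h0
    exact (Finset.mem_filter.1 hi).2 h0
  have h1 := Finset.card_le_card hsub
  rw [Finset.card_compl, Fintype.card_fin] at h1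
  have h2 := card_finset_fin_le A
  unfold codewordWeight at hw
  omega

/-- A set of deficient rank can be enlarged to corank one without losing nullity, which bounds
    its nullity. -/
theorem card_add_distance_add_rank_le {n k d : ℕ} {F : Type} [Field F] [DecidableEq F]
    (c : Fin n → Fin k → F) (hspan : Submodule.span F (Set.range c) = ⊤)
    (hd : HasDistance c d) (A : Finset (Fin n)) (hA : pointRank c A < k) :
    A.card + k + d ≤ n + pointRank c A + 1 := by
  by_cases h : pointRank c A + 1 = k
  · have := card_add_distance_le c hd A hA
    omega
  · obtain ⟨i, -, hi⟩ := exists_notMem_of_pointRank_lt c Set.univ (by rwa [Set.image_univ]) A hA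
    have h1 := pointRank_insert_le c A i
    have h2 := Finset.card_insert_of_notMem hi
    have h3 := card_finset_fin_le (insert i A)
    have h4 := card_add_distance_add_rank_le c hspan hd (insert i A) (by omega)
    omega
termination_by n - A.card

/-- In an optimal code, no set of rank less than `j * r` has nullity `j`, for `j ≤ k / r`. -/
theorem card_lt_pointRank_add {n k d r m : ℕ} {F : Type} [Field F] [DecidableEq F]
    (c : Fin n → Fin k → F) (hk : k = m * r) (hn : n + 2 = k + m + d)
    (hspan : Submodule.span F (Set.range c) = ⊤)
    (hd : HasDistance c d) (hloc : InfoLocality c r) {j : ℕ} (hj : j ≤ m)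
    (A : Finset (Fin n)) (hA : pointRank c A < j * r) : A.card < pointRank c A + j := by
  classical
  induction hj using Nat.decreasingInduction generalizing A with
  | self =>
    have := card_add_distance_add_rank_le c hspan hd A (by omega)
    omega
  | of_succ j hjm ih =>
    have hjr : j * r ≤ m * r := Nat.mul_le_mul_right r hjm.le
    obtain ⟨I, hI, hIloc⟩ := hloc
    obtain ⟨i, hiI, hiA⟩ := exists_notMem_of_pointRank_lt c I hI A (by omega)
    obtain ⟨R, hiR, hR, lam, hlam⟩ := hIloc i hiI
    have hstep := pointRank_union_lt c A (insert i R) i (Finset.mem_insert_self i R) hiA (by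
      rw [Finset.erase_insert hiR, hlam]
      exact Submodule.sum_mem _ fun l hl =>
        Submodule.smul_mem _ _ (Submodule.subset_span ⟨l, hl, rfl⟩))
    have h1 : (insert i R \ A).card ≤ r + 1 :=
      (Finset.card_le_card Finset.sdiff_subset).trans
        ((Finset.card_insert_le i R).trans (by omega))
    have h2 : (insert i R \ A).card + A.card = (A ∪ insert i R).card := by
      rw [Finset.union_comm, Finset.card_sdiff_add_card]
    have h3 := ih (A ∪ insert i R) (by rw [Nat.succ_mul]; omega)
    omega

/-- Every point of the support of a dual codeword is spanned by the other ones. -/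
theorem SmallDualSupport.mem_span_erase {n k r : ℕ} {F : Type} [Field F]
    {c : Fin n → Fin k → F} {S : Finset (Fin n)} (hS : SmallDualSupport c r S)
    {i : Fin n} (hi : i ∈ S) :
    c i ∈ Submodule.span F (c '' ((S.erase i : Finset (Fin n)) : Set (Fin n))) := by
  obtain ⟨-, -, lam, hne, hsum⟩ := hS
  rw [← Finset.add_sum_erase S _ hi] at hsum
  rw [← Submodule.smul_mem_iff _ (hne i hi), eq_neg_of_add_eq_zero_left hsum]
  exact Submodule.neg_mem _ (Submodule.sum_mem _ fun l hl =>
    Submodule.smul_mem _ _ (Submodule.subset_span ⟨l, hl, rfl⟩))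

/-- Structure theorem: in an optimal code with r ∣ k, r < k and n = k + k/r + d − 2,
    every support of a dual codeword of weight ≤ r+1 has size exactly r+1, and any two
    distinct such supports are disjoint. -/
theorem structure_theorem
    {F : Type} [Field F] [Fintype F] [DecidableEq F]
    {n k d r : ℕ} (hrk : r ∣ k) (hrlt : r < k)
    (hn : (n : ℤ) = k + k / r + d - 2)
    (c : Fin n → Fin k → F)
    (hspan : Submodule.span F (Set.range c) = ⊤)
    (hdist : HasDistance c d)
    (hloc : InfoLocality c r) :
    (∀ S : Finset (Fin n), SmallDualSupport c r S → S.card = r + 1) ∧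
    (∀ S T : Finset (Fin n), SmallDualSupport c r S → SmallDualSupport c r T →
      S ≠ T → Disjoint S T) := by
  classical
  obtain ⟨m, hm⟩ := hrk
  have hr : 0 < r := Nat.pos_of_ne_zero (by rintro rfl; omega)
  have hm2 : 2 ≤ m := by
    by_contra! h
    have : r * m ≤ r * 1 := Nat.mul_le_mul_left r (by omega)
    omega
  have hdiv : (k : ℤ) / r = m := by
    rw [hm, Nat.cast_mul, Int.mul_ediv_cancel_left _ (by omega)]
  rw [hdiv] at hn
  have key {j : ℕ} (hj : j ≤ m) (A : Finset (Fin n)) (hA : pointRank c A < j * r) :=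
    card_lt_pointRank_add c (hm.trans (mul_comm r m)) (by omega) hspan hdist hloc hj A hA
  have rank_lt_card (S : Finset (Fin n)) (hS : SmallDualSupport c r S) :
      pointRank c S < S.card := by
    obtain ⟨i, hi⟩ := hS.1
    have h := pointRank_union_lt c ∅ S i hi (Finset.notMem_empty i) (hS.mem_span_erase hi)
    have h0 : pointRank c ∅ = 0 := by simp [pointRank]
    rw [Finset.empty_union, Finset.sdiff_empty] at h
    omega
  have card_eq (S : Finset (Fin n)) (hS : SmallDualSupport c r S) : S.card = r + 1 := by
    refine le_antisymm hS.2.1 ?_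
    by_contra! hlt
    have h1 := rank_lt_card S hS
    have h2 := key (j := 1) (by omega) S (by omega)
    omega
  refine ⟨card_eq, fun S T hS hT hST => ?_⟩
  by_contra hdisj
  have hcS := card_eq S hS
  have hcT := card_eq T hT
  have hsub : ¬ T ⊆ S := fun h => hST (Finset.eq_of_subset_of_card_le h (by omega)).symm
  obtain ⟨i, hiT, hiS⟩ := Finset.not_subset.1 hsub
  have h1 := pointRank_union_lt c S T i hiT hiS (hT.mem_span_erase hiT)
  have h2 := rank_lt_card S hS
  have h3 : (T \ S).card + S.card = (S ∪ T).card := by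
    rw [Finset.union_comm, Finset.card_sdiff_add_card]
  have h4 := Finset.card_union_add_card_inter S T
  have h5 : 0 < (S ∩ T).card :=
    Finset.card_pos.2 (Finset.not_disjoint_iff_nonempty_inter.1 hdisj)
  have h6 := key hm2 (S ∪ T) (by omega)
  omega
end

section
/- Let n, k, r be positive integers and d ≥ 2, let q > k·n^k be a prime power, and suppose (r+1) | n and n − k = ⌈k/r⌉ + d − 2. Then there exists a linear [n,k,d]_q code in which every coordinate i ∈ [n] satisfies loc(c_i) ≤ r. -/
open Matrix Finset

open scoped Pointwise in
/-- A vector space over a field with `q` elements is not the union of fewer than `q` proper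
subspaces. -/
theorem exists_forall_notMem_of_card_lt {F V α : Type*} [Field F] [Fintype F] [AddCommGroup V]
    [Module F V] (s : Finset α) (U : α → Submodule F V) (hs : s.card < Fintype.card F)
    (hU : ∀ a ∈ s, U a ≠ ⊤) : ∃ v : V, ∀ a ∈ s, v ∉ U a := by
  by_contra! h
  have hcover : ⋃ a ∈ s, ((0 : V) +ᵥ ((U a).toAddSubgroup : Set V)) = Set.univ := by
    refine Set.eq_univ_of_forall fun v => ?_
    obtain ⟨a, ha, hv⟩ := h v
    simpa using ⟨a, ha, hv⟩
  obtain ⟨a, ha, hfin, hle⟩ := AddSubgroup.exists_index_le_card_of_leftCoset_cover hcover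
  have : Finite (V ⧸ U a) := AddSubgroup.finite_quotient_of_finiteIndex (H := (U a).toAddSubgroup)
  have : Nontrivial (V ⧸ U a) := Submodule.Quotient.nontrivial_iff.mpr (hU a ha)
  obtain ⟨w, hw⟩ := exists_ne (0 : V ⧸ U a)
  have hcard := Nat.card_le_card_of_injective (fun x : F => x • w) (smul_left_injective F hw)
  rw [Nat.card_eq_fintype_card] at hcard
  have hindex : (U a).toAddSubgroup.index = Nat.card (V ⧸ U a) := rfl
  omega

/-- Over a large finite field, a subspace disjoint from finitely many subspaces of dimension at
most `k` can be enlarged to one of codimension at most `k` with the same property. -/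
theorem exists_le_disjoint_finrank_le_add {F V α : Type*} [Field F] [Fintype F] [AddCommGroup V]
    [Module F V] [FiniteDimensional F V] (s : Finset α) (W : α → Submodule F V) {k : ℕ}
    (hs : s.card < Fintype.card F) (hW : ∀ a ∈ s, Module.finrank F (W a) ≤ k)
    (K : Submodule F V) (hK : ∀ a ∈ s, Disjoint K (W a)) :
    ∃ L, K ≤ L ∧ (∀ a ∈ s, Disjoint L (W a)) ∧
      Module.finrank F V ≤ Module.finrank F L + k := by
  have : Finite V := Module.finite_of_finite F
  have : Finite (Submodule F V) := Finite.of_injective _ SetLike.coe_injective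
  obtain ⟨L, hKL, hL⟩ := Finite.exists_le_maximal
    (p := fun L : Submodule F V => ∀ a ∈ s, Disjoint L (W a)) hK
  refine ⟨L, hKL, hL.prop, ?_⟩
  by_contra! hlt
  obtain ⟨v, hv⟩ := exists_forall_notMem_of_card_lt s (fun a => L ⊔ W a) hs fun a ha htop => by
    have hle := Submodule.finrank_add_le_finrank_add_finrank L (W a)
    rw [htop, finrank_top] at hle
    have := hW a ha
    omega
  have hdisj : ∀ a ∈ s, Disjoint (L ⊔ F ∙ v) (W a) := fun a ha => by
    rw [sup_comm]
    refine Disjoint.disjoint_sup_left_of_disjoint_sup_right (hL.prop a ha) ?_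
    rw [disjoint_comm, Submodule.disjoint_span_singleton]
    exact fun h => absurd h (hv a ha)
  have hvL : v ∈ L := hL.le_of_ge hdisj le_sup_left
    (Submodule.mem_sup_right (Submodule.mem_span_singleton_self v))
  have hne : s.Nonempty := by
    by_contra hempty
    rw [Finset.not_nonempty_iff_eq_empty] at hempty
    have htop : L = ⊤ := top_le_iff.mp (hL.le_of_ge (by simp [hempty]) le_top)
    rw [htop, finrank_top] at hlt
    omega
  obtain ⟨a, ha⟩ := hne
  exact hv a ha (Submodule.mem_sup_left hvL)

/-- If `k ≤ r * b` and all fibers of `Prod.fst ∘ e` have `r + 1` elements, then a set with at least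
`k + b - 1` elements contains a `k`-element set that contains no fiber. -/
theorem exists_subset_card_eq_forall_exists_notMem {ι : Type*} [DecidableEq ι] {m r k b : ℕ}
    (e : ι ≃ Fin m × Fin (r + 1)) (S : Finset ι) (hb : k ≤ r * b) (hS : k + b ≤ S.card + 1) :
    ∃ T ⊆ S, T.card = k ∧ ∀ a, ∃ j, e.symm (a, j) ∉ T := by
  classical
  let P : Finset (Fin m) := univ.filter fun a => ∀ j, e.symm (a, j) ∈ S
  let Q : Finset ι := P.image fun a => e.symm (a, 0)
  have hQ : Q.card = P.card := card_image_of_injective _ fun a a' h => by simpa using h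
  have hQS : Q ⊆ S := by
    intro i hi
    obtain ⟨a, ha, rfl⟩ := mem_image.mp hi
    exact (mem_filter.mp ha).2 0
  have hPS : P.card * (r + 1) ≤ S.card := by
    have hsub : (P ×ˢ univ).map e.symm.toEmbedding ⊆ S := by
      intro i hi
      obtain ⟨⟨a, j⟩, ha, rfl⟩ := mem_map.mp hi
      exact (mem_filter.mp (mem_product.mp ha).1).2 j
    simpa using card_le_card hsub
  have hk : k ≤ (S \ Q).card := by
    rw [card_sdiff_of_subset hQS, hQ]
    rcases Nat.lt_or_ge P.card b with h | h
    · omega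
    · have := Nat.mul_le_mul_left r h
      rw [mul_add, mul_comm] at hPS
      omega
  obtain ⟨T, hT, hTk⟩ := exists_subset_card_eq hk
  refine ⟨T, hT.trans sdiff_subset, hTk, fun a => ?_⟩
  by_cases ha : a ∈ P
  · exact ⟨0, fun h => (mem_sdiff.mp (hT h)).2 (mem_image_of_mem _ ha)⟩
  · obtain ⟨j, hj⟩ : ∃ j, e.symm (a, j) ∉ S := by simpa [P] using ha
    exact ⟨j, fun h => hj (mem_sdiff.mp (hT h)).1⟩

/-- The functions vanishing outside `T`. -/
def supportedOn (F : Type*) [Field F] {ι : Type*} (T : Finset ι) : Submodule F (ι → F) :=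
  LinearMap.ker (LinearMap.funLeft F F (Subtype.val : {i // i ∉ T} → ι))

theorem mem_supportedOn {F ι : Type*} [Field F] {T : Finset ι} {f : ι → F} :
    f ∈ supportedOn F T ↔ ∀ i ∉ T, f i = 0 := by
  simp [supportedOn, LinearMap.mem_ker, funext_iff, LinearMap.funLeft_apply]

theorem finrank_supportedOn {F ι : Type*} [Field F] [Fintype ι] [DecidableEq ι] (T : Finset ι) :
    Module.finrank F (supportedOn F T) = T.card := by
  have h : _ + Module.finrank F (supportedOn F T) = _ :=
    (LinearMap.funLeft F F (Subtype.val : {i // i ∉ T} → ι)).finrank_range_add_finrank_ker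
  rw [LinearMap.range_eq_top.mpr
    (LinearMap.funLeft_surjective_of_injective F F _ Subtype.val_injective), finrank_top,
    Module.finrank_fintype_fun_eq_card, Module.finrank_fintype_fun_eq_card,
    Fintype.card_subtype_compl, Fintype.card_coe] at h
  have := card_le_univ T
  omega

/-- For every partition of the coordinates into groups of size `r + 1` and every large finite field
there are points whose sum over each group vanishes, and such that any `k` points that contain no
complete group span the whole space. -/
theorem exists_points_sum_eq_zero {F ι : Type*} [Field F] [Fintype F] [Fintype ι] [DecidableEq ι]
    {m r k : ℕ} (e : ι ≃ Fin m × Fin (r + 1)) (hq : (Fintype.card ι).choose k < Fintype.card F)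
    (hT : ∃ T : Finset ι, T.card = k ∧ ∀ a, ∃ j, e.symm (a, j) ∉ T) :
    ∃ c : ι → Fin k → F, (∀ a, ∑ j, c (e.symm (a, j)) = 0) ∧
      ∀ T : Finset ι, T.card = k → (∀ a, ∃ j, e.symm (a, j) ∉ T) →
        Submodule.span F (c '' T) = ⊤ := by
  classical
  let s : Finset (Finset ι) :=
    (powersetCard k univ).filter fun T => ∀ a, ∃ j, e.symm (a, j) ∉ T
  have hmem : ∀ {T}, T ∈ s ↔ T.card = k ∧ ∀ a, ∃ j, e.symm (a, j) ∉ T := by simp [s]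
  have hs : s.card < Fintype.card F :=
    ((card_filter_le _ _).trans (by rw [card_powersetCard, card_univ])).trans_lt hq
  obtain ⟨L, hKL, hL, hrank⟩ := exists_le_disjoint_finrank_le_add s (supportedOn F) hs
    (fun T hT => (finrank_supportedOn T).trans_le (hmem.mp hT).1.le)
    (LinearMap.range (LinearMap.funLeft F F fun i => (e i).1)) (fun T hT => by
      rw [Submodule.disjoint_def]
      rintro _ ⟨h, rfl⟩ hh
      rw [mem_supportedOn] at hh
      ext i
      obtain ⟨j, hj⟩ := (hmem.mp hT).2 (e i).1
      simpa [LinearMap.funLeft_apply] using hh _ hj)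
  have hle : Module.finrank F L + k ≤ Module.finrank F (ι → F) := by
    obtain ⟨T, hT⟩ := hT
    have h := Submodule.finrank_add_finrank_le_of_disjoint (hL T (hmem.mpr hT))
    rwa [finrank_supportedOn, hT.1] at h
  have hquot : Module.finrank F ((ι → F) ⧸ L) = Module.finrank F (Fin k → F) := by
    have := L.finrank_quotient_add_finrank
    rw [Module.finrank_fin_fun]
    omega
  let E := LinearEquiv.ofFinrankEq _ _ hquot
  let φ : (ι → F) →ₗ[F] Fin k → F := E.toLinearMap ∘ₗ L.mkQ
  have hker : LinearMap.ker φ = L := by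
    simp [φ, LinearMap.ker_comp]
  refine ⟨fun i => φ (Pi.single i 1), fun a => ?_, fun T hTk hTa => ?_⟩
  · rw [← map_sum, ← LinearMap.mem_ker, hker]
    refine hKL ⟨Pi.single a 1, ?_⟩
    ext i
    obtain ⟨⟨a', j'⟩, rfl⟩ := e.symm.surjective i
    simp only [LinearMap.funLeft_apply, Equiv.apply_symm_apply, Finset.sum_apply, Pi.single_apply,
      EmbeddingLike.apply_eq_iff_eq, Prod.mk.injEq]
    by_cases h : a' = a <;> simp [h]
  · have hdisj := hL T (hmem.mpr ⟨hTk, hTa⟩)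
    have hmap : (supportedOn F T).map φ = ⊤ := by
      have hsup : L ⊔ supportedOn F T = ⊤ := Submodule.eq_top_of_disjoint _ _
        (by rw [finrank_supportedOn, hTk]; omega) hdisj
      have hmapL : L.map φ = ⊥ := LinearMap.le_ker_iff_map.mp hker.ge
      have hφ : LinearMap.range φ = ⊤ := by simp [φ, LinearMap.range_comp]
      rw [← hφ, LinearMap.range_eq_map, ← hsup, Submodule.map_sup, hmapL, bot_sup_eq]
    rw [eq_top_iff, ← hmap]
    rintro _ ⟨f, hf, rfl⟩
    rw [SetLike.mem_coe, mem_supportedOn] at hf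
    rw [pi_eq_sum_univ' f, map_sum]
    refine Submodule.sum_mem _ fun i _ => ?_
    by_cases hi : i ∈ T
    · rw [map_smul]
      exact Submodule.smul_mem _ _ (Submodule.subset_span ⟨i, hi, rfl⟩)
    · simp [hf i hi]

/-- If the points of each group of size `r + 1` sum to zero and `r * D < k`, then some nonzero vector
is orthogonal to at least `k - 1 + D` of the points. -/
theorem exists_ne_zero_le_card_dotProduct_eq_zero {F ι : Type*} [Field F] [DecidableEq F]
    [Fintype ι] [DecidableEq ι] {m r k D : ℕ} (e : ι ≃ Fin m × Fin (r + 1)) (c : ι → Fin k → F)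
    (hc : ∀ a, ∑ j, c (e.symm (a, j)) = 0) (hDk : r * D < k) (hDm : D ≤ m)
    (hcard : k + D ≤ Fintype.card ι + 1) :
    ∃ x : Fin k → F, x ≠ 0 ∧ k + D ≤ (univ.filter fun i => c i ⬝ᵥ x = 0).card + 1 := by
  obtain ⟨P, -, hP⟩ := exists_subset_card_eq (s := (univ : Finset (Fin m))) (n := D) (by simpa)
  let Q : Finset ι := P.map ⟨fun a => e.symm (a, 0), fun a a' h => by simpa using h⟩
  let A : Finset ι := (P ×ˢ univ).map
    ⟨fun p : Fin m × Fin r => e.symm (p.1, p.2.succ), fun p p' h => by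
      simpa [Prod.ext_iff] using h⟩
  have hQ : Q.card = D := by simp [Q, hP]
  have hA : A.card = D * r := by simp [A, hP]
  have hAQ : A ⊆ univ \ Q := by
    intro i hi
    obtain ⟨p, -, rfl⟩ := mem_map.mp hi
    simp only [mem_sdiff, mem_univ, true_and]
    intro h
    obtain ⟨a, -, ha⟩ := mem_map.mp h
    have := congrArg Prod.snd (e.symm.injective ha)
    exact (Fin.succ_ne_zero _ this.symm).elim
  obtain ⟨B, hAB, hBQ, hB⟩ := exists_subsuperset_card_eq (n := k - 1) hAQ
    (by rw [hA, mul_comm]; omega)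
    (by rw [card_sdiff_of_subset (subset_univ _), card_univ, hQ]; omega)
  let f : (Fin k → F) →ₗ[F] B → F := LinearMap.pi fun i => dotProductBilin F F (c i)
  obtain ⟨x, hx, hx0⟩ := (Submodule.ne_bot_iff _).mp (f.ker_ne_bot_of_finrank_lt (by
    rw [Module.finrank_fintype_fun_eq_card, Fintype.card_coe, hB, Module.finrank_fin_fun]
    omega))
  have hxB : ∀ i ∈ B, c i ⬝ᵥ x = 0 := fun i hi => congrFun (LinearMap.mem_ker.mp hx) ⟨i, hi⟩
  refine ⟨x, hx0, ?_⟩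
  have hsub : B ∪ Q ⊆ univ.filter fun i => c i ⬝ᵥ x = 0 := by
    refine union_subset (fun i hi => by simp [hxB i hi]) fun i hi => ?_
    obtain ⟨a, ha, rfl⟩ := mem_map.mp hi
    have hsucc : ∀ j : Fin r, c (e.symm (a, j.succ)) ⬝ᵥ x = 0 := fun j =>
      hxB _ (hAB (mem_map.mpr ⟨(a, j), by simp [ha], rfl⟩))
    have hsum := congrArg (· ⬝ᵥ x) (hc a)
    simp only [Fin.sum_univ_succ, add_dotProduct, sum_dotProduct, hsucc, sum_const_zero, add_zero,
      zero_dotProduct] at hsum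
    exact mem_filter.mpr ⟨mem_univ _, hsum⟩
  have hdisj : Disjoint B Q := disjoint_left.mpr fun i hi => (mem_sdiff.mp (hBQ hi)).2
  have := card_le_card hsub
  rw [card_union_of_disjoint hdisj, hB, hQ] at this
  omega

/-- A point of a group of `r + 1` points with sum zero is a combination of the `r` other points. -/
theorem locLE_of_sum_eq_zero {F : Type} [Field F] {n k m r : ℕ}
    (e : Fin n ≃ Fin m × Fin (r + 1)) (c : Fin n → Fin k → F)
    (hc : ∀ a, ∑ j, c (e.symm (a, j)) = 0) (i : Fin n) : LocLE c i r := by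
  obtain ⟨⟨a, j⟩, rfl⟩ := e.symm.surjective i
  let g : Fin (r + 1) ↪ Fin n := ⟨fun j => e.symm (a, j), fun j j' h => by simpa using h⟩
  refine ⟨(univ.erase j).map g, (mem_map' g).not.mpr (notMem_erase j univ), by simp,
    fun _ => -1, ?_⟩
  have h := hc a
  rw [← add_sum_erase _ _ (mem_univ j)] at h
  rw [sum_map, ← smul_sum, neg_one_smul]
  exact eq_neg_of_add_eq_zero_left h

/-- For positive n, k, r, d ≥ 2, q > k·n^k, (r+1) ∣ n and n − k = ⌈k/r⌉ + d − 2, there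
    exists an [n,k,d]_q code in which every symbol has locality at most r. -/
theorem non_canonical_all_symbol_locality
    {F : Type} [Field F] [Fintype F] [DecidableEq F]
    {n k r d : ℕ} (hn : 0 < n) (hk : 0 < k) (hr : 0 < r) (hd : 2 ≤ d)
    (hq : k * n ^ k < Fintype.card F)
    (hdvd : (r + 1) ∣ n)
    (heq : (n : ℤ) - k = ⌈(k : ℚ) / r⌉ + d - 2) :
    ∃ c : Fin n → Fin k → F,
      Submodule.span F (Set.range c) = ⊤ ∧
      HasDistance c d ∧
      ∀ i : Fin n, LocLE c i r := by
  obtain ⟨m, rfl⟩ := hdvd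
  obtain ⟨b, hb⟩ : ∃ b : ℕ, (b : ℤ) = ⌈(k : ℚ) / r⌉ :=
    ⟨_, Int.toNat_of_nonneg (Int.ceil_nonneg (by positivity))⟩
  have hr' : (0 : ℚ) < r := by exact_mod_cast hr
  have hkb : k ≤ r * b := by
    have h := Int.le_ceil ((k : ℚ) / r)
    rw [← hb, div_le_iff₀ hr', mul_comm] at h
    exact_mod_cast h
  have hbk : r * b < k + r := by
    have h := Int.ceil_lt_add_one ((k : ℚ) / r)
    rw [← hb, div_add_one hr'.ne', lt_div_iff₀ hr', mul_comm] at h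
    exact_mod_cast h
  rw [← hb] at heq
  obtain ⟨D, rfl⟩ : ∃ D, b = D + 1 := Nat.exists_eq_succ_of_ne_zero (by rintro rfl; omega)
  have hn' : (r + 1) * m + 1 = k + D + d := by
    zify
    push_cast at heq
    linarith
  have hDk : r * D < k := by rw [mul_add] at hbk; omega
  have hDm : D ≤ m := by
    by_contra! h
    have := Nat.mul_le_mul_left (r + 1) h
    nlinarith
  let e : Fin ((r + 1) * m) ≃ Fin m × Fin (r + 1) :=
    (finCongr (mul_comm _ _)).trans finProdFinEquiv.symm
  have hchoose : (Fintype.card (Fin ((r + 1) * m))).choose k < Fintype.card F := by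
    rw [Fintype.card_fin]
    exact ((Nat.choose_le_pow _ _).trans (Nat.le_mul_of_pos_left _ hk)).trans_lt hq
  have hsubset := fun S => exists_subset_card_eq_forall_exists_notMem (k := k) e S hkb
  obtain ⟨c, hsum, hspan⟩ := exists_points_sum_eq_zero (k := k) e hchoose (by
    obtain ⟨T, -, hT⟩ := hsubset univ (by rw [card_univ, Fintype.card_fin]; omega)
    exact ⟨T, hT⟩)
  have hweight : ∀ x : Fin k → F,
      (univ.filter fun i => c i ⬝ᵥ x = 0).card + codewordWeight c x = (r + 1) * m := fun x => by
    rw [codewordWeight, card_filter_add_card_filter_not, card_univ, Fintype.card_fin]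
  have hlower : ∀ x : Fin k → F, x ≠ 0 → d ≤ codewordWeight c x := by
    intro x hx
    by_contra! hlt
    obtain ⟨T, hTS, hTk, hT⟩ := hsubset (univ.filter fun i => c i ⬝ᵥ x = 0) (by
      have := hweight x
      omega)
    refine hx (dotProduct_eq_zero x fun y => ?_)
    have hy : y ∈ Submodule.span F (c '' T) := by simp [hspan T hTk hT]
    rw [dotProduct_comm]
    induction hy using Submodule.span_induction with
    | mem y hy =>
      obtain ⟨i, hi, rfl⟩ := hy
      exact (mem_filter.mp (hTS hi)).2
    | zero => simp
    | add y z _ _ hy hz => rw [add_dotProduct, hy, hz, add_zero]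
    | smul a y _ hy => rw [smul_dotProduct, hy, smul_zero]
  refine ⟨c, ?_, ⟨hlower, ?_⟩, locLE_of_sum_eq_zero e c hsum⟩
  · obtain ⟨T, -, hTk, hT⟩ := hsubset univ (by rw [card_univ, Fintype.card_fin]; omega)
    exact top_le_iff.mp ((hspan T hTk hT).symm.le.trans
      (Submodule.span_mono (Set.image_subset_range c T)))
  · obtain ⟨x, hx, hle⟩ := exists_ne_zero_le_card_dotProduct_eq_zero e c hsum hDk hDm
      (by rw [Fintype.card_fin]; omega)
    have := hweight x
    exact ⟨x, hx, le_antisymm (by omega) (hlower x hx)⟩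
end
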